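/- For every integer n > 5 and every integer k with 0 ≤ k ≤ n−5, there is no linear invariant normalization condition for (m, g) = (s^{k,n}, g): there is no linear subspace N ⊆ C²₊(m,g), invariant under the g⁰-action and spanned by weight-homogeneous elements, with C²₊(m,g) = N ⊕ ∂(C¹₊(m,g)). -/

import Mathlib

noncomputable section

open scoped BigOperators

/-- The underlying vector space of `gl₂(ℝ)`, with basis `Y, H, E, X` at indices `0,1,2,3`. -/
abbrev G2 : Type := Fin 4 → ℝ

/-- The underlying vector space of the Heisenberg algebra `heis_{2n-5}`:
coefficients of `ε_1, …, ε_{2n-6}` together with the coefficient of `η`. -/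
abbrev Hs (n : ℕ) : Type := (Fin (2*n-6) → ℝ) × ℝ

/-- The underlying vector space of `g = gl₂(ℝ) ⋉ heis_{2n-5}`. -/
abbrev Gg (n : ℕ) : Type := G2 × Hs n

/-- The basis vector `ε_p` (1-based index `p`). -/
def epsV (n : ℕ) (p : ℕ) : Hs n := (fun i => if i.val + 1 = p then 1 else 0, 0)

/-- The central basis vector `η`. -/
def etaV (n : ℕ) : Hs n := (0, 1)

/-- The Heisenberg bracket, encoding `[ε_i, ε_{2n-5-i}] = (-1)^i η`. -/
def heisBr (n : ℕ) (x y : Hs n) : Hs n :=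
  (0, ∑ i : Fin (2*n-6), (-1 : ℝ)^(i.val+1) * x.1 i * y.1 i.rev)

/-- The `gl₂(ℝ)` bracket: `[X,Y]=H`, `[H,X]=2X`, `[H,Y]=-2Y`, and `E` is central. -/
def gl2Br (a b : G2) : G2 :=
  ![-2*(a 1 * b 0 - a 0 * b 1), a 3 * b 0 - a 0 * b 3, 0, 2*(a 1 * b 3 - a 3 * b 1)]

/-- The map `φ : gl₂(ℝ) → End(heis_{2n-5})` from the paper. -/
def phi (n : ℕ) (a : G2) (v : Hs n) : Hs n :=
  (fun i =>
      a 1 * (2*(i.val:ℝ) + 7 - 2*(n:ℝ)) * v.1 i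
    + a 2 * v.1 i
    + a 3 * (if h : 0 < i.val then v.1 ⟨i.val - 1, by have := i.isLt; omega⟩ else 0)
    + a 0 * (((i.val:ℝ)+1) * (2*(n:ℝ) - 7 - (i.val:ℝ))) *
        (if h : i.val + 1 < 2*n-6 then v.1 ⟨i.val+1, h⟩ else 0),
   2 * a 2 * v.2)

/-- The bracket of the semidirect product `g = gl₂(ℝ) ⋉_φ heis_{2n-5}`. -/
def gBr (n : ℕ) (x y : Gg n) : Gg n :=
  (gl2Br x.1 y.1, phi n x.1 y.2 - phi n y.1 x.2 + heisBr n x.2 y.2)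

def bY (n : ℕ) : Gg n := (![1,0,0,0], 0)
def bH (n : ℕ) : Gg n := (![0,1,0,0], 0)
def bE (n : ℕ) : Gg n := (![0,0,1,0], 0)
def bX (n : ℕ) : Gg n := (![0,0,0,1], 0)
def bEps (n : ℕ) (p : ℕ) : Gg n := (0, epsV n p)
def bEta (n : ℕ) : Gg n := (0, etaV n)

/-- The weight-`w` graded component of `g` in the grading of `s^{k,n}`: the span of the
basis elements of weight `w`, where `wght Y = 1`, `wght H = wght E = 0`, `wght X = -1`,
`wght ε_p = n-4-k-p`, `wght η = -3-2k`. -/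
def gComp (n k : ℕ) (w : ℤ) : Submodule ℝ (Gg n) :=
  Submodule.span ℝ {v : Gg n |
    (v = bY n ∧ w = 1) ∨ ((v = bH n ∨ v = bE n) ∧ w = 0) ∨ (v = bX n ∧ w = -1) ∨
    (∃ p : ℕ, 1 ≤ p ∧ p ≤ 2*n-6 ∧ v = bEps n p ∧ w = (n:ℤ) - 4 - (k:ℤ) - (p:ℤ)) ∨
    (v = bEta n ∧ w = -3 - 2*(k:ℤ))}

/-- The negative part `m = s^{k,n}` of `g` (for `0 ≤ k ≤ n-4`): the span of the basis
elements of negative weight, i.e. of `X`, `ε_p` for `n-3-k ≤ p ≤ 2n-6`, and `η`. -/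
def mSub (n k : ℕ) : Submodule ℝ (Gg n) where
  carrier := {x | x.1 0 = 0 ∧ x.1 1 = 0 ∧ x.1 2 = 0 ∧
    ∀ i : Fin (2*n-6), ((i.val:ℤ) + 1 < (n:ℤ) - 3 - (k:ℤ) → x.2.1 i = 0)}
  add_mem' := by
    rintro a b ⟨ha0, ha1, ha2, ha3⟩ ⟨hb0, hb1, hb2, hb3⟩
    exact ⟨by simp [ha0, hb0], by simp [ha1, hb1], by simp [ha2, hb2],
      fun i hi => by simp [ha3 i hi, hb3 i hi]⟩
  zero_mem' := ⟨rfl, rfl, rfl, fun i _ => rfl⟩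
  smul_mem' := by
    rintro c a ⟨ha0, ha1, ha2, ha3⟩
    exact ⟨by simp [ha0], by simp [ha1], by simp [ha2], fun i hi => by simp [ha3 i hi]⟩

/-- The non-negative part `g⁰` of `g` in the grading of `s^{k,n}`. -/
def g0Sub (n k : ℕ) : Submodule ℝ (Gg n) where
  carrier := {x | x.1 3 = 0 ∧ x.2.2 = 0 ∧
    ∀ i : Fin (2*n-6), ((n:ℤ) - 3 - (k:ℤ) ≤ (i.val:ℤ) + 1 → x.2.1 i = 0)}
  add_mem' := by
    rintro a b ⟨ha0, ha1, ha3⟩ ⟨hb0, hb1, hb3⟩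
    exact ⟨by simp [ha0, hb0], by simp [ha1, hb1], fun i hi => by simp [ha3 i hi, hb3 i hi]⟩
  zero_mem' := ⟨rfl, rfl, fun i _ => rfl⟩
  smul_mem' := by
    rintro c a ⟨ha0, ha1, ha3⟩
    exact ⟨by simp [ha0], by simp [ha1], fun i hi => by simp [ha3 i hi]⟩

/-- The negative part `m` of `g`, as a type. -/
abbrev MT (n k : ℕ) := ↥(mSub n k)

/-- The projection `π_m : g → m` along `g⁰`. -/
def Pm (n k : ℕ) (x : Gg n) : Gg n :=
  (![0, 0, 0, x.1 3],
   (fun i => if (n:ℤ) - 3 - (k:ℤ) ≤ (i.val:ℤ) + 1 then x.2.1 i else 0, x.2.2))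

lemma Pm_mem (n k : ℕ) (x : Gg n) : Pm n k x ∈ mSub n k := by
  refine ⟨?_, ?_, ?_, fun i hi => ?_⟩
  · simp [Pm]
  · simp [Pm]
  · simp [Pm]
  · show (if (n:ℤ) - 3 - (k:ℤ) ≤ (i.val:ℤ) + 1 then x.2.1 i else 0) = 0
    rw [if_neg (by omega)]

/-- The projection `π_m : g → m`, viewed as a map into `m`. -/
def ptoM (n k : ℕ) (x : Gg n) : MT n k := ⟨Pm n k x, Pm_mem n k x⟩

/-- The Lie bracket of `m` (the bracket of `g` restricted to `m`; since `m` is closed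
under the bracket, composing with the projection `π_m` does not change the value). -/
def mBrM (n k : ℕ) (x y : MT n k) : MT n k := ptoM n k (gBr n x.1 y.1)

/-- `ψ` is an ℝ-linear map `m → g`, i.e. an element of `C¹(m,g)`. -/
def IsLin1 (n k : ℕ) (ψ : MT n k → Gg n) : Prop :=
  (∀ x y, ψ (x + y) = ψ x + ψ y) ∧ ∀ (c : ℝ) (x), ψ (c • x) = c • ψ x

/-- `ψ` is an alternating ℝ-bilinear map `m × m → g`, i.e. an element of `C²(m,g)`. -/
def IsAlt2 (n k : ℕ) (ψ : MT n k → MT n k → Gg n) : Prop :=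
  (∀ y, IsLin1 n k (fun x => ψ x y)) ∧ (∀ x, IsLin1 n k (ψ x)) ∧ ∀ x, ψ x x = 0

/-- The coboundary `∂ : C¹(m,g) → C²(m,g)`,
`(∂φ)(x,y) = [x, φ y] - [y, φ x] + φ [x,y]`. -/
def cobound (n k : ℕ) (φ : MT n k → Gg n) : MT n k → MT n k → Gg n :=
  fun x y => gBr n x.1 (φ y) - gBr n y.1 (φ x) + φ (mBrM n k x y)

/-- A 1-cochain is homogeneous of weight `w` if `ψ(g_p) ⊆ g_{p+w}` for all `p < 0`. -/
def Homog1 (n k : ℕ) (w : ℤ) (ψ : MT n k → Gg n) : Prop :=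
  ∀ p : ℤ, p < 0 → ∀ x : MT n k, (x : Gg n) ∈ gComp n k p → ψ x ∈ gComp n k (p + w)

/-- A 2-cochain is homogeneous of weight `w` if `ψ(g_p × g_q) ⊆ g_{p+q+w}` for `p,q < 0`. -/
def Homog2 (n k : ℕ) (w : ℤ) (ψ : MT n k → MT n k → Gg n) : Prop :=
  ∀ p q : ℤ, p < 0 → q < 0 → ∀ x y : MT n k,
    (x : Gg n) ∈ gComp n k p → (y : Gg n) ∈ gComp n k q → ψ x y ∈ gComp n k (p + q + w)

/-- `C¹₊(m,g)`: the span of the homogeneous 1-cochains of positive weight. -/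
def C1plus (n k : ℕ) : Submodule ℝ (MT n k → Gg n) :=
  Submodule.span ℝ {ψ | IsLin1 n k ψ ∧ ∃ w : ℤ, 0 < w ∧ Homog1 n k w ψ}

/-- `C²₊(m,g)`: the span of the homogeneous alternating 2-cochains of positive weight. -/
def C2plus (n k : ℕ) : Submodule ℝ (MT n k → MT n k → Gg n) :=
  Submodule.span ℝ {ψ | IsAlt2 n k ψ ∧ ∃ w : ℤ, 0 < w ∧ Homog2 n k w ψ}

/-- The image `∂(C¹₊(m,g)) ⊆ C²(m,g)`. -/
def imDel (n k : ℕ) : Submodule ℝ (MT n k → MT n k → Gg n) :=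
  Submodule.span ℝ (cobound n k '' {φ | φ ∈ C1plus n k})

/-- The action of `A ∈ g⁰` on 1-cochains: `(A·ψ)(x) = [A, ψ x] - ψ(π_m [A, x])`. -/
def act1 (n k : ℕ) (A : Gg n) (ψ : MT n k → Gg n) : MT n k → Gg n :=
  fun x => gBr n A (ψ x) - ψ (ptoM n k (gBr n A x.1))

/-- The action of `A ∈ g⁰` on 2-cochains:
`(A·ψ)(x,y) = [A, ψ x y] - ψ(π_m [A, x]) y - ψ x (π_m [A, y])`. -/
def act2 (n k : ℕ) (A : Gg n) (ψ : MT n k → MT n k → Gg n) : MT n k → MT n k → Gg n :=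
  fun x y => gBr n A (ψ x y) - ψ (ptoM n k (gBr n A x.1)) y - ψ x (ptoM n k (gBr n A y.1))

/-- The coefficient of `ε_p` (the dual functional `ε*_p`). -/
def epsCoef (n : ℕ) (p : ℕ) (x : Gg n) : ℝ :=
  if h : 1 ≤ p ∧ p ≤ 2*n-6 then x.2.1 ⟨p-1, by omega⟩ else 0

/-- The 1-cochain `ε*_{n-3-k} ⊗ ε_{2n-6}`. -/
def cA (n k : ℕ) : MT n k → Gg n := fun x => epsCoef n (n-3-k) x.1 • bEps n (2*n-6)

/-- The 1-cochain `X* ⊗ ε_{n-4-k}`. -/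
def cB (n k : ℕ) : MT n k → Gg n := fun x => (x : Gg n).1 3 • bEps n (n-4-k)

/-- The 2-cochain `X* ∧ ε*_{n-1+k} ⊗ η`. -/
def cC (n k : ℕ) : MT n k → MT n k → Gg n := fun x y =>
  ((x : Gg n).1 3 * epsCoef n (n-1+k) y.1 - (y : Gg n).1 3 * epsCoef n (n-1+k) x.1) • bEta n

/-- The 2-cochain `ε*_{n-3-k} ∧ η* ⊗ ε_{2n-6}`. -/
def cD (n k : ℕ) : MT n k → MT n k → Gg n := fun x y =>
  (epsCoef n (n-3-k) x.1 * (y : Gg n).2.2 - epsCoef n (n-3-k) y.1 * (x : Gg n).2.2) • bEps n (2*n-6)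

section Bracket

variable {n : ℕ}

lemma gBr_add_right (x y z : Gg n) : gBr n x (y + z) = gBr n x y + gBr n x z := by
  ext i
  · fin_cases i <;> simp [gBr, gl2Br] <;> ring
  · simp only [gBr, phi, heisBr, Prod.fst_add, Prod.snd_add, Pi.add_apply, Prod.fst_sub, Pi.sub_apply]
    split_ifs <;> simp <;> ring
  · simp [gBr, phi, heisBr, mul_add, Finset.sum_add_distrib]
    ring

lemma gBr_smul_right (c : ℝ) (x y : Gg n) : gBr n x (c • y) = c • gBr n x y := by
  ext i
  · fin_cases i <;> simp [gBr, gl2Br] <;> ring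
  · simp only [gBr, phi, heisBr, Prod.fst_add, Prod.smul_fst, Prod.smul_snd, Pi.smul_apply,
      Pi.add_apply, Prod.fst_sub, Pi.sub_apply, smul_eq_mul]
    split_ifs <;> simp <;> ring
  · simp only [gBr, phi, heisBr, Prod.snd_add, Prod.smul_fst, Prod.smul_snd, Pi.smul_apply,
      Prod.snd_sub, smul_eq_mul, mul_add, mul_sub, Finset.mul_sum]
    congr 1
    · ring
    · exact Finset.sum_congr rfl fun i _ => by ring

lemma gBr_zero_right (x : Gg n) : gBr n x 0 = 0 := by
  simpa using gBr_smul_right (n := n) 0 x 0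

lemma gBr_sub_right (x y z : Gg n) : gBr n x (y - z) = gBr n x y - gBr n x z := by
  rw [sub_eq_add_neg, ← neg_one_smul ℝ z, gBr_add_right, gBr_smul_right, neg_one_smul,
    ← sub_eq_add_neg]

lemma heisBr_swap (x y : Hs n) : heisBr n y x = -heisBr n x y := by
  ext i
  · simp [heisBr]
  · simp only [heisBr, Prod.snd_neg, ← Finset.sum_neg_distrib]
    rw [← Equiv.sum_comp Fin.revPerm]
    refine Finset.sum_congr rfl fun i _ => ?_
    have h : (-1 : ℝ) ^ ((Fin.rev i).val + 1) = -(-1) ^ (i.val + 1) := by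
      have h1 : ((Fin.rev i).val + 1) + (i.val + 1) = 2 * (n - 3) + 1 := by
        have := i.isLt
        rw [Fin.val_rev]
        omega
      have h2 : (-1 : ℝ) ^ ((Fin.rev i).val + 1) * (-1) ^ (i.val + 1) = -1 := by
        rw [← pow_add, h1, pow_succ, pow_mul]
        simp
      rcases neg_one_pow_eq_or ℝ (i.val + 1) with h3 | h3 <;> rw [h3] at h2 ⊢ <;> linarith
    simp only [Fin.revPerm_apply, Fin.rev_rev, h]
    ring

lemma gBr_swap (x y : Gg n) : gBr n y x = -gBr n x y := by
  refine Prod.ext ?_ ?_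
  · ext i
    fin_cases i <;> simp [gBr, gl2Br] <;> ring
  · simp only [gBr, Prod.snd_neg, heisBr_swap x.2 y.2]
    abel

/-- The element `aH + bE` of the torus of `gl₂(ℝ)`. -/
def tor (n : ℕ) (a b : ℝ) : Gg n := (![0, a, b, 0], 0)

lemma gBr_tor (a b : ℝ) (x : Gg n) : gBr n (tor n a b) x =
    (![-2 * a * x.1 0, 0, 0, 2 * a * x.1 3],
      (fun i => (a * (2 * (i.val : ℝ) + 7 - 2 * (n : ℝ)) + b) * x.2.1 i, 2 * b * x.2.2)) := by
  ext i
  · fin_cases i <;> simp [gBr, gl2Br, tor] <;> ring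
  · simp [gBr, phi, heisBr, tor]
    ring
  · simp [gBr, phi, heisBr, tor]

/-- The sequence `v` shifted by one place, so that `φ(X)` is `shiftDown` on the `ε_i`. -/
def shiftDown (v : Fin (2 * n - 6) → ℝ) (i : Fin (2 * n - 6)) : ℝ :=
  if h : 0 < i.val then v ⟨i.val - 1, by have := i.isLt; omega⟩ else 0

/-- The sequence `v` shifted by one place in the direction of `φ(Y)`. -/
def shiftUp (v : Fin (2 * n - 6) → ℝ) (i : Fin (2 * n - 6)) : ℝ :=
  if h : i.val + 1 < 2 * n - 6 then v ⟨i.val + 1, h⟩ else 0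

lemma phi_fst_apply (a : G2) (v : Hs n) (i : Fin (2 * n - 6)) : (phi n a v).1 i =
    a 1 * (2 * (i.val : ℝ) + 7 - 2 * (n : ℝ)) * v.1 i + a 2 * v.1 i + a 3 * shiftDown v.1 i +
      a 0 * (((i.val : ℝ) + 1) * (2 * (n : ℝ) - 7 - (i.val : ℝ))) * shiftUp v.1 i := rfl

lemma shiftDown_weight (a b : ℝ) (v : Fin (2 * n - 6) → ℝ) (i : Fin (2 * n - 6)) :
    shiftDown (fun j => (a * (2 * (j.val : ℝ) + 7 - 2 * (n : ℝ)) + b) * v j) i =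
      (a * (2 * (i.val : ℝ) + 5 - 2 * (n : ℝ)) + b) * shiftDown v i := by
  unfold shiftDown
  by_cases h : 0 < i.val
  · rw [dif_pos h, dif_pos h]
    simp only [Nat.cast_pred h]
    ring
  · rw [dif_neg h, dif_neg h, mul_zero]

lemma shiftUp_weight (a b : ℝ) (v : Fin (2 * n - 6) → ℝ) (i : Fin (2 * n - 6)) :
    shiftUp (fun j => (a * (2 * (j.val : ℝ) + 7 - 2 * (n : ℝ)) + b) * v j) i =
      (a * (2 * (i.val : ℝ) + 9 - 2 * (n : ℝ)) + b) * shiftUp v i := by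
  unfold shiftUp
  by_cases h : i.val + 1 < 2 * n - 6
  · rw [dif_pos h, dif_pos h]
    push_cast
    ring
  · rw [dif_neg h, dif_neg h, mul_zero]

/-- Elements of the torus act on `g` by derivations. -/
lemma gBr_tor_gBr (a b : ℝ) (x y : Gg n) : gBr n (tor n a b) (gBr n x y) =
    gBr n (gBr n (tor n a b) x) y + gBr n x (gBr n (tor n a b) y) := by
  simp only [gBr_tor]
  ext i
  · fin_cases i <;> simp [gBr, gl2Br] <;> ring
  · simp only [gBr, Prod.fst_add, Prod.snd_add, Prod.fst_sub, Pi.add_apply, Pi.sub_apply,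
      phi_fst_apply, shiftDown_weight, shiftUp_weight, heisBr]
    simp
    ring
  · simp only [gBr, phi, heisBr, Prod.snd_add, Prod.snd_sub]
    have h : ∀ i : Fin (2 * n - 6), (2 * ((Fin.rev i).val : ℝ) + 7 - 2 * (n : ℝ)) =
        -(2 * (i.val : ℝ) + 7 - 2 * (n : ℝ)) := by
      intro i
      have h1 : (Fin.rev i).val + i.val + 7 = 2 * n := by
        have := i.isLt
        rw [Fin.val_rev]
        omega
      have h2 : ((Fin.rev i).val : ℝ) + i.val + 7 = 2 * n := by exact_mod_cast h1
      linarith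
    have h2 : 2 * b * (∑ i : Fin (2 * n - 6), (-1 : ℝ) ^ (i.val + 1) * x.2.1 i * y.2.1 i.rev) =
        (∑ i : Fin (2 * n - 6), (-1 : ℝ) ^ (i.val + 1) *
          ((a * (2 * (i.val : ℝ) + 7 - 2 * (n : ℝ)) + b) * x.2.1 i) * y.2.1 i.rev) +
        ∑ i : Fin (2 * n - 6), (-1 : ℝ) ^ (i.val + 1) * x.2.1 i *
          ((a * (2 * ((Fin.rev i).val : ℝ) + 7 - 2 * (n : ℝ)) + b) * y.2.1 i.rev) := by
      rw [← Finset.sum_add_distrib, Finset.mul_sum]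
      refine Finset.sum_congr rfl fun i _ => ?_
      rw [h]
      ring
    simp [-Fin.val_rev]
    linear_combination h2

lemma gBr_tor_bEps (a b : ℝ) (p : ℕ) :
    gBr n (tor n a b) (bEps n p) = (a * (2 * (p : ℝ) + 5 - 2 * n) + b) • bEps n p := by
  rw [gBr_tor]
  ext i
  · fin_cases i <;> simp [bEps]
  · simp only [bEps, epsV, Prod.smul_mk, Pi.smul_apply, smul_eq_mul]
    split_ifs with h
    · have : (p : ℝ) = i.val + 1 := by rw [← h]; simp
      rw [this]
      ring
    · simp
  · simp [bEps, epsV]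

lemma gBr_add_left (x y z : Gg n) : gBr n (x + y) z = gBr n x z + gBr n y z := by
  rw [gBr_swap z, gBr_swap z x, gBr_swap z y, gBr_add_right, neg_add]

lemma gBr_smul_left (c : ℝ) (x z : Gg n) : gBr n (c • x) z = c • gBr n x z := by
  rw [gBr_swap z, gBr_swap z x, gBr_smul_right, smul_neg]

/-- The bracket of `ε_j` with an element having no component along `Y`, `H`, `E`. -/
lemma gBr_bEps {j : ℕ} (h1 : 1 ≤ j) (h2 : j ≤ 2 * n - 6) {x : Gg n} (hY : x.1 0 = 0)
    (hH : x.1 1 = 0) (hE : x.1 2 = 0) : gBr n (bEps n j) x =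
      -(x.1 3) • bEps n (j + 1) + ((-1) ^ j * epsCoef n (2 * n - 5 - j) x) • bEta n := by
  ext i
  · fin_cases i <;> simp [gBr, gl2Br, bEps, bEta]
  · have h : shiftDown (epsV n j).1 i = if i.val + 1 = j + 1 then 1 else 0 := by
      unfold shiftDown epsV
      split_ifs <;> first | rfl | (exfalso; omega) | skip
      all_goals simp; omega
    simp only [gBr, bEps, bEta, Prod.snd_add, Prod.fst_add, Prod.fst_sub, Pi.add_apply,
      Pi.sub_apply, phi_fst_apply, h, hY, hH, hE]
    simp [heisBr, etaV, epsV]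
  · have h : (heisBr n (epsV n j) x.2).2 = (-1) ^ j * epsCoef n (2 * n - 5 - j) x := by
      rw [epsCoef, dif_pos (by omega)]
      simp only [heisBr, epsV]
      rw [Finset.sum_eq_single ⟨j - 1, by omega⟩]
      · have h3 : (⟨j - 1, by omega⟩ : Fin (2 * n - 6)).rev = ⟨2 * n - 5 - j - 1, by omega⟩ := by
          ext
          rw [Fin.val_rev]
          simp only
          omega
        rw [h3]
        simp [Nat.sub_add_cancel h1]
      · intro i _ hi
        rw [if_neg]
        · simp
        · rintro rfl
          exact hi (by ext; simp)
      · simp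
    simp only [gBr, bEps, bEta, Prod.snd_add, Prod.snd_sub, h]
    simp [phi, hE, etaV, epsV]

lemma epsCoef_add (p : ℕ) (x y : Gg n) : epsCoef n p (x + y) = epsCoef n p x + epsCoef n p y := by
  unfold epsCoef
  split_ifs <;> simp

lemma epsCoef_smul (p : ℕ) (c : ℝ) (x : Gg n) : epsCoef n p (c • x) = c * epsCoef n p x := by
  unfold epsCoef
  split_ifs <;> simp

lemma epsCoef_bEps {p : ℕ} (h1 : 1 ≤ p) (h2 : p ≤ 2 * n - 6) (r : ℕ) :
    epsCoef n p (bEps n r) = if p = r then 1 else 0 := by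
  rw [epsCoef, dif_pos ⟨h1, h2⟩]
  simp [bEps, epsV, Nat.sub_add_cancel h1]

lemma epsCoef_bEta (p : ℕ) : epsCoef n p (bEta n) = 0 := by
  unfold epsCoef
  split_ifs <;> simp [bEta, etaV]

lemma epsCoef_gBr_tor (a b : ℝ) (p : ℕ) (x : Gg n) : epsCoef n p (gBr n (tor n a b) x) =
    (a * (2 * (p : ℝ) + 5 - 2 * n) + b) * epsCoef n p x := by
  rw [gBr_tor]
  unfold epsCoef
  split_ifs with h
  · simp only [Nat.cast_pred h.1]
    ring
  · simp

/-- The eigenspaces of `E` on `g` for eigenvalues `0, 1, 2`. -/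
lemma eq_zero_of_gBr_E {c : ℝ} {z : Gg n} (h : gBr n (tor n 0 1) z = c • z) :
    (c ≠ 0 → z.1 = 0) ∧ (c ≠ 1 → z.2.1 = 0) ∧ (c ≠ 2 → z.2.2 = 0) := by
  rw [gBr_tor] at h
  refine ⟨fun hc => ?_, fun hc => ?_, fun hc => ?_⟩
  · have h1 := congrArg Prod.fst h
    ext i
    have h2 := congrFun h1 i
    fin_cases i <;> simpa [hc] using h2
  · ext i
    have h1 := congrFun (congrArg (fun u => u.2.1) h) i
    simp only [Prod.smul_snd, Prod.smul_fst, Pi.smul_apply, smul_eq_mul] at h1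
    have h2 : (c - 1) * z.2.1 i = 0 := by linarith
    exact (mul_eq_zero.mp h2).resolve_left (sub_ne_zero.mpr hc)
  · have h1 := congrArg (fun u => u.2.2) h
    simp only [Prod.smul_snd, smul_eq_mul] at h1
    have h2 : (c - 2) * z.2.2 = 0 := by linarith
    exact (mul_eq_zero.mp h2).resolve_left (sub_ne_zero.mpr hc)

end Bracket

section Grading

variable {n k : ℕ}

lemma gBr_tor_mem_gComp (a b : ℝ) {w : ℤ} {x : Gg n} (hx : x ∈ gComp n k w) :
    gBr n (tor n a b) x ∈ gComp n k w := by
  unfold gComp at hx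
  induction hx using Submodule.span_induction with
  | zero => rw [gBr_zero_right]; exact zero_mem _
  | add x y _ _ hx hy => rw [gBr_add_right]; exact add_mem hx hy
  | smul c x _ hx => rw [gBr_smul_right]; exact Submodule.smul_mem _ _ hx
  | mem v hv =>
    suffices h : ∃ c : ℝ, gBr n (tor n a b) v = c • v by
      obtain ⟨c, hc⟩ := h
      rw [hc]
      exact Submodule.smul_mem _ _ (Submodule.subset_span hv)
    rcases hv with ⟨rfl, -⟩ | ⟨rfl | rfl, -⟩ | ⟨rfl, -⟩ | ⟨p, -, -, rfl, -⟩ | ⟨rfl, -⟩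
    · refine ⟨-2 * a, ?_⟩
      rw [gBr_tor]
      ext i
      · fin_cases i <;> simp [bY]
      · simp [bY]
      · simp [bY]
    · refine ⟨0, ?_⟩
      rw [gBr_tor]
      ext i
      · fin_cases i <;> simp [bH]
      · simp [bH]
      · simp [bH]
    · refine ⟨0, ?_⟩
      rw [gBr_tor]
      ext i
      · fin_cases i <;> simp [bE]
      · simp [bE]
      · simp [bE]
    · refine ⟨2 * a, ?_⟩
      rw [gBr_tor]
      ext i
      · fin_cases i <;> simp [bX]
      · simp [bX]
      · simp [bX]
    · exact ⟨_, gBr_tor_bEps a b p⟩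
    · refine ⟨2 * b, ?_⟩
      rw [gBr_tor]
      ext i
      · fin_cases i <;> simp [bEta]
      · simp [bEta, etaV]
      · simp [bEta, etaV]

lemma gComp_coef_X {w : ℤ} {x : Gg n} (hx : x ∈ gComp n k w) (hw : w ≠ -1) : x.1 3 = 0 := by
  unfold gComp at hx
  induction hx using Submodule.span_induction with
  | zero => simp
  | add x y _ _ hx hy => simp [hx, hy]
  | smul c x _ hx => simp [hx]
  | mem v hv =>
    rcases hv with ⟨rfl, -⟩ | ⟨rfl | rfl, -⟩ | ⟨rfl, h⟩ | ⟨p, -, -, rfl, -⟩ | ⟨rfl, -⟩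
    · simp [bY]
    · simp [bH]
    · simp [bE]
    · exact absurd h hw
    · simp [bEps]
    · simp [bEta]

lemma gComp_coef_eps {w : ℤ} {x : Gg n} (hx : x ∈ gComp n k w) {p : ℕ}
    (hw : w ≠ (n : ℤ) - 4 - k - p) : epsCoef n p x = 0 := by
  unfold epsCoef
  split_ifs with hp
  swap
  · rfl
  unfold gComp at hx
  induction hx using Submodule.span_induction with
  | zero => simp
  | add x y _ _ hx hy => simp [hx, hy]
  | smul c x _ hx => simp [hx]
  | mem v hv =>
    rcases hv with ⟨rfl, -⟩ | ⟨rfl | rfl, -⟩ | ⟨rfl, -⟩ | ⟨r, -, -, rfl, h⟩ | ⟨rfl, -⟩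
    · simp [bY]
    · simp [bH]
    · simp [bE]
    · simp [bX]
    · simp only [bEps, epsV]
      rw [if_neg]
      rintro rfl
      apply hw
      rw [h]
      push_cast
      omega
    · simp [bEta, etaV]

lemma gComp_coef_eta {w : ℤ} {x : Gg n} (hx : x ∈ gComp n k w) (hw : w ≠ -3 - 2 * k) :
    x.2.2 = 0 := by
  unfold gComp at hx
  induction hx using Submodule.span_induction with
  | zero => simp
  | add x y _ _ hx hy => simp [hx, hy]
  | smul c x _ hx => simp [hx]
  | mem v hv =>
    rcases hv with ⟨rfl, -⟩ | ⟨rfl | rfl, -⟩ | ⟨rfl, -⟩ | ⟨p, -, -, rfl, -⟩ | ⟨rfl, h⟩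
    · simp [bY]
    · simp [bH]
    · simp [bE]
    · simp [bX]
    · simp [bEps, epsV]
    · exact absurd h hw

lemma bEps_mem_gComp {p : ℕ} (h1 : 1 ≤ p) (h2 : p ≤ 2 * n - 6) {w : ℤ}
    (hw : w = (n : ℤ) - 4 - k - p) : bEps n p ∈ gComp n k w :=
  Submodule.subset_span (Or.inr (Or.inr (Or.inr (Or.inl ⟨p, h1, h2, rfl, hw⟩))))

end Grading

section Cochains

variable {n k : ℕ}

lemma Pm_eq_self {x : Gg n} (hx : x ∈ mSub n k) : Pm n k x = x := by
  obtain ⟨h0, h1, h2, h3⟩ := hx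
  ext i
  · fin_cases i <;> simp [Pm, h0, h1, h2]
  · simp only [Pm]
    split_ifs with h
    · rfl
    · exact (h3 i (by omega)).symm
  · rfl

lemma ptoM_coe_eq {x : Gg n} (hx : x ∈ mSub n k) : ((ptoM n k x : MT n k) : Gg n) = x :=
  Pm_eq_self hx

lemma ptoM_add (x y : Gg n) : ptoM n k (x + y) = ptoM n k x + ptoM n k y := by
  refine Subtype.ext ?_
  ext i
  · fin_cases i <;> simp [ptoM, Pm]
  · simp only [ptoM, Pm, Submodule.coe_add, Prod.fst_add, Prod.snd_add, Pi.add_apply]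
    split_ifs <;> simp
  · simp [ptoM, Pm]

lemma ptoM_smul (c : ℝ) (x : Gg n) : ptoM n k (c • x) = c • ptoM n k x := by
  refine Subtype.ext ?_
  ext i
  · fin_cases i <;> simp [ptoM, Pm]
  · simp only [ptoM, Pm, Submodule.coe_smul, Prod.smul_fst, Prod.smul_snd, Pi.smul_apply]
    split_ifs <;> simp
  · simp [ptoM, Pm]

lemma gBr_tor_mem_mSub (a b : ℝ) {x : Gg n} (hx : x ∈ mSub n k) :
    gBr n (tor n a b) x ∈ mSub n k := by
  obtain ⟨h0, h1, h2, h3⟩ := hx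
  rw [gBr_tor]
  refine ⟨by simp [h0], by simp, by simp, fun i hi => ?_⟩
  simp [h3 i hi]

lemma gBr_mem_mSub {x y : Gg n} (hx : x ∈ mSub n k) (hy : y ∈ mSub n k) :
    gBr n x y ∈ mSub n k := by
  obtain ⟨h0, h1, h2, h3⟩ := hx
  obtain ⟨g0, g1, g2, g3⟩ := hy
  refine ⟨by simp [gBr, gl2Br, h0, g0], by simp [gBr, gl2Br, h0, g0], by simp [gBr, gl2Br],
    fun i hi => ?_⟩
  simp only [gBr, phi, heisBr, h0, h1, h2, g0, g1, g2]
  by_cases hi0 : 0 < i.val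
  · have h4 := h3 ⟨i.val - 1, by have := i.isLt; omega⟩ (by simp; omega)
    have g4 := g3 ⟨i.val - 1, by have := i.isLt; omega⟩ (by simp; omega)
    simp [h4, g4]
  · simp [hi0]

lemma act1_tor_isLin1 (a b : ℝ) {φ : MT n k → Gg n} (h : IsLin1 n k φ) :
    IsLin1 n k (act1 n k (tor n a b) φ) := by
  refine ⟨fun x y => ?_, fun c x => ?_⟩
  · simp only [act1, h.1, Submodule.coe_add, gBr_add_right, ptoM_add]
    abel
  · simp only [act1, h.2, Submodule.coe_smul, gBr_smul_right, ptoM_smul, smul_sub]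

lemma isLin1_of_mem_C1plus {φ : MT n k → Gg n} (h : φ ∈ C1plus n k) : IsLin1 n k φ := by
  unfold C1plus at h
  induction h using Submodule.span_induction with
  | zero => exact ⟨by simp, by simp⟩
  | mem v hv => exact hv.1
  | add x y _ _ hx hy =>
    refine ⟨fun u v => ?_, fun c u => ?_⟩
    · simp only [Pi.add_apply, hx.1, hy.1]
      abel
    · simp only [Pi.add_apply, hx.2, hy.2, smul_add]
  | smul c x _ hx =>
    refine ⟨fun u v => ?_, fun d u => ?_⟩
    · simp only [Pi.smul_apply, hx.1, smul_add]
    · simp only [Pi.smul_apply, hx.2, smul_comm c d]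

lemma act1_tor_mem_C1plus (a b : ℝ) {φ : MT n k → Gg n} (h : φ ∈ C1plus n k) :
    act1 n k (tor n a b) φ ∈ C1plus n k := by
  unfold C1plus at h
  induction h using Submodule.span_induction with
  | zero =>
    convert (C1plus n k).zero_mem using 1
    ext x : 1
    simp [act1, gBr_zero_right]
  | mem v hv =>
    obtain ⟨hl, w, hw, hh⟩ := hv
    refine Submodule.subset_span ⟨act1_tor_isLin1 a b hl, w, hw, fun p hp x hx => ?_⟩
    refine sub_mem (gBr_tor_mem_gComp a b (hh p hp x hx)) (hh p hp _ ?_)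
    rw [ptoM_coe_eq (gBr_tor_mem_mSub a b x.2)]
    exact gBr_tor_mem_gComp a b hx
  | add x y _ _ hx hy =>
    convert add_mem hx hy using 1
    ext u : 1
    simp only [act1, Pi.add_apply, gBr_add_right]
    abel
  | smul c x _ hx =>
    convert Submodule.smul_mem _ c hx using 1
    ext u : 1
    simp only [act1, Pi.smul_apply, gBr_smul_right, smul_sub]

/-- The coboundary is equivariant under the torus. -/
lemma act2_tor_cobound (a b : ℝ) {φ : MT n k → Gg n} (h : IsLin1 n k φ) :
    act2 n k (tor n a b) (cobound n k φ) = cobound n k (act1 n k (tor n a b) φ) := by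
  ext x y : 2
  have hc : ∀ u : MT n k, ((ptoM n k (gBr n (tor n a b) u.1) : MT n k) : Gg n) =
      gBr n (tor n a b) u.1 := fun u => ptoM_coe_eq (gBr_tor_mem_mSub a b u.2)
  have hb : ptoM n k (gBr n (tor n a b) (mBrM n k x y).1) =
      mBrM n k (ptoM n k (gBr n (tor n a b) x.1)) y +
        mBrM n k x (ptoM n k (gBr n (tor n a b) y.1)) := by
    simp only [mBrM, hc, ← ptoM_add, ← gBr_tor_gBr]
    rw [ptoM_coe_eq (gBr_mem_mSub x.2 y.2)]
  simp only [act2, cobound, act1, gBr_add_right, gBr_sub_right, gBr_tor_gBr, hc, hb, h.1]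
  abel

lemma exists_of_mem_imDel {δ : MT n k → MT n k → Gg n} (h : δ ∈ imDel n k) :
    ∃ φ ∈ C1plus n k, δ = cobound n k φ := by
  unfold imDel at h
  induction h using Submodule.span_induction with
  | zero =>
    refine ⟨0, zero_mem _, ?_⟩
    ext x y : 2
    simp [cobound, gBr_zero_right]
  | mem v hv =>
    obtain ⟨φ, hφ, rfl⟩ := hv
    exact ⟨φ, hφ, rfl⟩
  | add x y _ _ hx hy =>
    obtain ⟨φ, hφ, rfl⟩ := hx
    obtain ⟨χ, hχ, rfl⟩ := hy
    refine ⟨φ + χ, add_mem hφ hχ, ?_⟩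
    ext u v : 2
    simp only [cobound, Pi.add_apply, gBr_add_right]
    abel
  | smul c x _ hx =>
    obtain ⟨φ, hφ, rfl⟩ := hx
    refine ⟨c • φ, Submodule.smul_mem _ c hφ, ?_⟩
    ext u v : 2
    simp only [cobound, Pi.smul_apply, gBr_smul_right, smul_sub, smul_add]

lemma act2_tor_mem_imDel (a b : ℝ) {δ : MT n k → MT n k → Gg n} (h : δ ∈ imDel n k) :
    act2 n k (tor n a b) δ ∈ imDel n k := by
  obtain ⟨φ, hφ, rfl⟩ := exists_of_mem_imDel h
  rw [act2_tor_cobound a b (isLin1_of_mem_C1plus hφ)]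
  exact Submodule.subset_span ⟨_, act1_tor_mem_C1plus a b hφ, rfl⟩

lemma act2_add (A : Gg n) (ψ χ : MT n k → MT n k → Gg n) :
    act2 n k A (ψ + χ) = act2 n k A ψ + act2 n k A χ := by
  ext x y : 2
  simp only [act2, Pi.add_apply, gBr_add_right]
  abel

lemma tor_mem_g0Sub (a b : ℝ) : tor n a b ∈ g0Sub n k :=
  ⟨by simp [tor], rfl, fun _ _ => rfl⟩

/-- The 2-cochain `ε*_{n-3-k} ∧ η* ⊗ ε_{n-1+k}`. -/
def topCochain (n k : ℕ) : MT n k → MT n k → Gg n := fun x y =>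
  (epsCoef n (n-3-k) x.1 * (y : Gg n).2.2 - epsCoef n (n-3-k) y.1 * (x : Gg n).2.2) •
    bEps n (n-1+k)

lemma epsCoef_ptoM {p : ℕ} (hp : n - 3 - k ≤ p) (z : Gg n) :
    epsCoef n p ((ptoM n k z : MT n k) : Gg n) = epsCoef n p z := by
  unfold epsCoef
  split_ifs with h
  · simp only [ptoM, Pm]
    rw [if_pos]
    omega
  · rfl

lemma bEps_mem_mSub {p : ℕ} (hp : n - 3 - k ≤ p) : bEps n p ∈ mSub n k := by
  refine ⟨rfl, rfl, rfl, fun i hi => ?_⟩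
  simp only [bEps, epsV]
  rw [if_neg]
  omega

lemma bEta_mem_mSub : bEta n ∈ mSub n k := ⟨rfl, rfl, rfl, fun _ _ => rfl⟩

lemma bX_mem_mSub : bX n ∈ mSub n k := ⟨rfl, rfl, rfl, fun _ _ => rfl⟩

lemma cobound_swap {φ : MT n k → Gg n} (h : IsLin1 n k φ) (x y : MT n k) :
    cobound n k φ y x = -cobound n k φ x y := by
  have hb : mBrM n k y x = (-1 : ℝ) • mBrM n k x y := by
    rw [mBrM, mBrM, gBr_swap x.1, ← ptoM_smul, neg_one_smul]
  simp only [cobound, hb, h.2]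
  module

lemma cobound_add_right {φ : MT n k → Gg n} (h : IsLin1 n k φ) (x y z : MT n k) :
    cobound n k φ x (y + z) = cobound n k φ x y + cobound n k φ x z := by
  simp only [cobound, mBrM, h.1, Submodule.coe_add, gBr_add_right, gBr_add_left, ptoM_add]
  abel

lemma cobound_smul_right {φ : MT n k → Gg n} (h : IsLin1 n k φ) (c : ℝ) (x y : MT n k) :
    cobound n k φ x (c • y) = c • cobound n k φ x y := by
  simp only [cobound, mBrM, h.2, Submodule.coe_smul, gBr_smul_right, gBr_smul_left, ptoM_smul]
  module

lemma cobound_add_left {φ : MT n k → Gg n} (h : IsLin1 n k φ) (x y z : MT n k) :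
    cobound n k φ (x + y) z = cobound n k φ x z + cobound n k φ y z := by
  rw [cobound_swap h z, cobound_swap h z x, cobound_swap h z y, cobound_add_right h, neg_add]

lemma cobound_smul_left {φ : MT n k → Gg n} (h : IsLin1 n k φ) (c : ℝ) (x y : MT n k) :
    cobound n k φ (c • x) y = c • cobound n k φ x y := by
  rw [cobound_swap h y, cobound_swap h y x, cobound_smul_right h, smul_neg]

/-- The values of a torus eigenvector on eigenvectors are eigenvectors. -/
lemma gBr_tor_cobound_of_eigen {φ : MT n k → Gg n} (h : IsLin1 n k φ) {a b l : ℝ}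
    (hl : act2 n k (tor n a b) (cobound n k φ) = l • cobound n k φ) {x y : MT n k} {c d : ℝ}
    (hx : gBr n (tor n a b) x.1 = c • x.1) (hy : gBr n (tor n a b) y.1 = d • y.1) :
    gBr n (tor n a b) (cobound n k φ x y) = (l + c + d) • cobound n k φ x y := by
  have hm : ∀ z : MT n k, ptoM n k z.1 = z := fun z => Subtype.ext (ptoM_coe_eq z.2)
  have h1 := congrFun (congrFun hl x) y
  simp only [act2, hx, hy, ptoM_smul, hm, cobound_smul_left h, cobound_smul_right h,
    Pi.smul_apply] at h1
  rw [sub_sub, sub_eq_iff_eq_add] at h1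
  rw [h1]
  module

/-- On elements of the Heisenberg part, the `gl₂`-component of `∂φ` is that of `φ([x,y])`. -/
lemma cobound_fst_of_heis {φ : MT n k → Gg n} (h : IsLin1 n k φ) {x y : MT n k}
    (hx : x.1.1 = 0) (hy : y.1.1 = 0) : (cobound n k φ x y).1 =
      (heisBr n x.1.2 y.1.2).2 • (φ ⟨bEta n, bEta_mem_mSub⟩).1 := by
  have hb : mBrM n k x y = (heisBr n x.1.2 y.1.2).2 • ⟨bEta n, bEta_mem_mSub⟩ := by
    refine Subtype.ext ?_
    rw [mBrM, ptoM_coe_eq (gBr_mem_mSub x.2 y.2), gBr, hx, hy]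
    ext i
    · fin_cases i <;> simp [gl2Br, bEta]
    · simp [phi, heisBr, bEta, etaV]
    · simp [phi, bEta, etaV]
  have h0 : ∀ z : G2, gl2Br 0 z = 0 := fun z => by
    ext i
    fin_cases i <;> simp [gl2Br]
  rw [cobound, hb, h.2]
  simp [gBr, hx, hy, h0]

/-- A coboundary of `E`-weight `-2` and `H`-weight different from `-2`, `0`, `2` vanishes. -/
lemma cobound_eq_zero (hn : 5 < n) (hk : k ≤ n - 5) {φ : MT n k → Gg n} (h : IsLin1 n k φ)
    {l : ℝ} (hl : 2 < l) (hE : act2 n k (tor n 0 1) (cobound n k φ) = (-2 : ℝ) • cobound n k φ)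
    (hH : act2 n k (tor n 1 0) (cobound n k φ) = l • cobound n k φ) : cobound n k φ = 0 := by
  set e : MT n k := ⟨bEta n, bEta_mem_mSub⟩ with he
  set X : MT n k := ⟨bX n, bX_mem_mSub⟩ with hX
  have hZ : (φ e).1 = 0 := by
    have hx := gBr_tor_bEps (n := n) 1 0 (n - 3 - k)
    have hy := gBr_tor_bEps (n := n) 1 0 (n - 2 + k)
    have h1 := gBr_tor_cobound_of_eigen h hH (x := ⟨_, bEps_mem_mSub le_rfl⟩)
      (y := ⟨_, bEps_mem_mSub (by omega)⟩) hx hy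
    have hb : (heisBr n (bEps n (n - 3 - k)).2 (bEps n (n - 2 + k)).2).2 =
        (-1) ^ (n - 3 - k) := by
      have h2 := congrArg (fun u => u.2.2) (gBr_bEps (n := n) (j := n - 3 - k) (by omega)
        (by omega) (x := bEps n (n - 2 + k)) rfl rfl rfl)
      rw [show 2 * n - 5 - (n - 3 - k) = n - 2 + k by omega,
        epsCoef_bEps (by omega) (by omega)] at h2
      simpa [gBr, phi, bEps, epsV, bEta, etaV] using h2
    have h2 := congrArg Prod.fst h1
    rw [Prod.smul_fst, cobound_fst_of_heis h rfl rfl, hb, gBr_tor] at h2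
    simp only [cobound_fst_of_heis h (x := ⟨_, bEps_mem_mSub le_rfl⟩)
      (y := ⟨bEps n (n - 2 + k), bEps_mem_mSub (by omega)⟩) rfl rfl, hb] at h2
    have hw : l + (1 * (2 * ((n - 3 - k : ℕ) : ℝ) + 5 - 2 * n) + 0) +
        (1 * (2 * ((n - 2 + k : ℕ) : ℝ) + 5 - 2 * n) + 0) = l := by
      rw [Nat.cast_sub (by omega), Nat.cast_sub (by omega), Nat.cast_add, Nat.cast_sub (by omega)]
      push_cast
      ring
    rw [hw] at h2
    ext i
    have h3 := congrFun h2 i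
    have hs : ((-1 : ℝ) ^ (n - 3 - k)) ≠ 0 := pow_ne_zero _ (by norm_num)
    simp only [Pi.smul_apply, smul_eq_mul] at h3
    have h4 : ∀ c : ℝ, c < l → c * ((-1) ^ (n - 3 - k) * (φ e).1 i) =
        l * ((-1) ^ (n - 3 - k) * (φ e).1 i) → (φ e).1 i = 0 := by
      intro c hc h5
      have h6 : (l - c) * ((-1) ^ (n - 3 - k) * (φ e).1 i) = 0 := by linarith
      exact (mul_eq_zero.mp ((mul_eq_zero.mp h6).resolve_left (by linarith))).resolve_left hs
    fin_cases i
    · exact h4 (-2) (by linarith) (by simpa using h3)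
    · exact h4 0 (by linarith) (by simpa using h3)
    · exact h4 0 (by linarith) (by simpa using h3)
    · exact h4 2 (by linarith) (by simpa using h3)
  have hm : ∀ x : MT n k, ((0, (x.1.2.1, 0)) : Gg n) ∈ mSub n k :=
    fun x => ⟨rfl, rfl, rfl, x.2.2.2.2⟩
  set u : MT n k → MT n k := fun x => ⟨_, hm x⟩ with hu
  have hdec : ∀ x : MT n k, x = x.1.1 3 • X + u x + x.1.2.2 • e := by
    intro x
    obtain ⟨h0, h1, h2, -⟩ := x.2
    refine Subtype.ext ?_
    ext i
    · fin_cases i <;> simp [hX, hu, he, bX, bEta, h0, h1, h2]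
    · simp [hX, hu, he, bX, bEta, etaV]
    · simp [hX, hu, he, bX, bEta, etaV]
  have eX : gBr n (tor n 0 1) X.1 = (0 : ℝ) • X.1 := by
    rw [gBr_tor]
    ext i
    · fin_cases i <;> simp
    · simp [hX, bX]
    · simp [hX, bX]
  have eu : ∀ x, gBr n (tor n 0 1) (u x).1 = (1 : ℝ) • (u x).1 := by
    intro x
    rw [gBr_tor]
    ext i
    · fin_cases i <;> simp [hu]
    · simp
    · simp [hu]
  have ee : gBr n (tor n 0 1) e.1 = (2 : ℝ) • e.1 := by
    rw [gBr_tor]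
    ext i
    · fin_cases i <;> simp [he, bEta]
    · simp [he, bEta, etaV]
    · simp
  have d0 : ∀ x y : MT n k, cobound n k φ x y = 0 → cobound n k φ y x = 0 := by
    intro x y hxy
    rw [cobound_swap h, hxy, neg_zero]
  have dself : ∀ x : MT n k, cobound n k φ x x = 0 := fun x =>
    self_eq_neg.mp (cobound_swap h x x)
  have dXu : ∀ x, cobound n k φ X (u x) = 0 := by
    intro x
    obtain ⟨h1, h2, h3⟩ := eq_zero_of_gBr_E (gBr_tor_cobound_of_eigen h hE eX (eu x))
    exact Prod.ext (h1 (by norm_num)) (Prod.ext (h2 (by norm_num)) (h3 (by norm_num)))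
  have duu : ∀ x y, cobound n k φ (u x) (u y) = 0 := by
    intro x y
    obtain ⟨-, h2, h3⟩ := eq_zero_of_gBr_E (gBr_tor_cobound_of_eigen h hE (eu x) (eu y))
    refine Prod.ext ?_ (Prod.ext (h2 (by norm_num)) (h3 (by norm_num)))
    rw [cobound_fst_of_heis h rfl rfl, hZ, smul_zero]
    rfl
  have dXe : cobound n k φ X e = 0 := by
    obtain ⟨-, h2, h3⟩ := eq_zero_of_gBr_E (gBr_tor_cobound_of_eigen h hE eX ee)
    refine Prod.ext ?_ (Prod.ext (h2 (by norm_num)) (h3 (by norm_num)))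
    have hb : mBrM n k X e = (0 : ℝ) • X := by
      refine Subtype.ext ?_
      rw [mBrM, ptoM_coe_eq (gBr_mem_mSub X.2 e.2)]
      ext i
      · fin_cases i <;> simp [gBr, gl2Br, he, bEta]
      · simp [gBr, phi, heisBr, he, hX, bEta, bX, etaV]
      · simp [gBr, phi, heisBr, he, hX, bEta, bX]
    rw [cobound, hb, h.2, zero_smul, add_zero]
    ext i
    simp only [gBr, Prod.fst_sub, hZ]
    fin_cases i <;> simp [gl2Br, he, bEta]
  have due : ∀ x, cobound n k φ (u x) e = 0 := by
    intro x
    obtain ⟨h1, -, h3⟩ := eq_zero_of_gBr_E (gBr_tor_cobound_of_eigen h hE (eu x) ee)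
    refine Prod.ext (h1 (by norm_num)) (Prod.ext ?_ (h3 (by norm_num)))
    have hb : mBrM n k (u x) e = (0 : ℝ) • X := by
      refine Subtype.ext ?_
      rw [mBrM, ptoM_coe_eq (gBr_mem_mSub (u x).2 e.2)]
      ext i
      · fin_cases i <;> simp [gBr, gl2Br, he, hu, bEta]
      · simp [gBr, phi, heisBr, he, hu, bEta, etaV]
      · simp [gBr, phi, heisBr, he, hu, bEta, etaV]
    rw [cobound, hb, h.2, zero_smul, add_zero]
    ext i
    simp only [gBr, Prod.fst_sub, Prod.snd_sub, hZ]
    simp [phi, heisBr, he, hu, bEta, etaV]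
  ext x y : 2
  rw [hdec x, hdec y]
  simp only [cobound_add_left h, cobound_add_right h, cobound_smul_left h, cobound_smul_right h,
    dself, dXu, d0 _ _ (dXu _), duu, dXe, d0 _ _ dXe, due, d0 _ _ (due _), smul_zero, add_zero,
    Pi.zero_apply]

lemma act2_tor_topCochain (hn : 5 < n) (hk : k ≤ n - 5) (a b : ℝ) :
    act2 n k (tor n a b) (topCochain n k) = (a * (4 * k + 4) - 2 * b) • topCochain n k := by
  ext x y : 2
  have ht : ∀ x : MT n k, ((ptoM n k (gBr n (tor n a b) x.1) : MT n k) : Gg n).2.2 =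
      2 * b * x.1.2.2 := fun x => by
    rw [gBr_tor]
    rfl
  simp only [act2, topCochain, Pi.smul_apply, epsCoef_ptoM le_rfl, epsCoef_gBr_tor, ht,
    gBr_smul_right, gBr_tor_bEps]
  rw [Nat.cast_sub (by omega), Nat.cast_sub (by omega), Nat.cast_add, Nat.cast_sub (by omega)]
  push_cast
  module

lemma topCochain_mem_C2plus (hn : 5 < n) (hk : k ≤ n - 5) : topCochain n k ∈ C2plus n k := by
  refine Submodule.subset_span ⟨⟨fun y => ⟨fun x z => ?_, fun c x => ?_⟩,
    fun y => ⟨fun x z => ?_, fun c x => ?_⟩, fun x => ?_⟩, 1, one_pos, ?_⟩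
  · simp only [topCochain, Submodule.coe_add, epsCoef_add, Prod.snd_add]
    module
  · simp only [topCochain, Submodule.coe_smul, epsCoef_smul, Prod.smul_snd, smul_eq_mul]
    module
  · simp only [topCochain, Submodule.coe_add, epsCoef_add, Prod.snd_add]
    module
  · simp only [topCochain, Submodule.coe_smul, epsCoef_smul, Prod.smul_snd, smul_eq_mul]
    module
  · simp only [topCochain, sub_self, zero_smul]
  · have key : ∀ p q : ℤ, ∀ x y : MT n k, (x : Gg n) ∈ gComp n k p → (y : Gg n) ∈ gComp n k q →
        (epsCoef n (n-3-k) x.1 * (y : Gg n).2.2) • bEps n (n-1+k) ∈ gComp n k (p + q + 1) := by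
      intro p q x y hx hy
      by_cases hp : p = -1
      · by_cases hq : q = -3 - 2 * k
        · exact Submodule.smul_mem _ _ (bEps_mem_gComp (by omega) (by omega) (by omega))
        · simp [gComp_coef_eta hy hq]
      · rw [gComp_coef_eps hx (by omega)]
        simp
    intro p q _ _ x y hx hy
    simp only [topCochain, sub_smul]
    refine sub_mem (key p q x y hx hy) ?_
    rw [add_comm p q]
    exact key q p y x hy hx

/-- Applying `ε_{n-4-k}` three times to `topCochain` gives a multiple of `cC`. -/
lemma act2_act2_act2_topCochain (hn : 5 < n) (hk : k ≤ n - 5) :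
    act2 n k (bEps n (n-4-k)) (act2 n k (bEps n (n-4-k)) (act2 n k (bEps n (n-4-k))
      (topCochain n k))) = (-6 : ℝ) • cC n k := by
  set s : ℝ := (-1) ^ (n - 4 - k) with hs
  have hss : s * s = 1 := by
    rw [hs, ← mul_pow]
    simp
  have hb : ∀ x : MT n k, gBr n (bEps n (n-4-k)) x.1 = -(x.1.1 3) • bEps n (n-3-k) +
      (s * epsCoef n (n-1+k) x.1) • bEta n := by
    intro x
    rw [gBr_bEps (by omega) (by omega) x.2.1 x.2.2.1 x.2.2.2.1,
      show n - 4 - k + 1 = n - 3 - k by omega, show 2 * n - 5 - (n - 4 - k) = n - 1 + k by omega]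
  set θ : MT n k → MT n k := fun x => ptoM n k (gBr n (bEps n (n-4-k)) x.1) with hθ
  have tp : ∀ x, epsCoef n (n-3-k) (θ x).1 = -(x.1.1 3) := by
    intro x
    rw [hθ, epsCoef_ptoM le_rfl, hb, epsCoef_add, epsCoef_smul, epsCoef_smul,
      epsCoef_bEps (by omega) (by omega), epsCoef_bEta]
    simp
  have tq : ∀ x, epsCoef n (n-1+k) (θ x).1 = 0 := by
    intro x
    rw [hθ, epsCoef_ptoM (by omega), hb, epsCoef_add, epsCoef_smul, epsCoef_smul,
      epsCoef_bEps (by omega) (by omega), epsCoef_bEta, if_neg (by omega)]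
    simp
  have te : ∀ x, (θ x).1.2.2 = s * epsCoef n (n-1+k) x.1 := by
    intro x
    change (gBr n (bEps n (n-4-k)) x.1).2.2 = _
    rw [hb]
    simp [bEps, epsV, bEta, etaV]
  have tX : ∀ x, (θ x).1.1 3 = 0 := by
    intro x
    change (gBr n (bEps n (n-4-k)) x.1).1 3 = _
    rw [hb]
    simp [bEps, bEta]
  have bq : gBr n (bEps n (n-4-k)) (bEps n (n-1+k)) = s • bEta n := by
    have h1 := hb ⟨_, bEps_mem_mSub (by omega : n - 3 - k ≤ n - 1 + k)⟩
    rw [h1, epsCoef_bEps (by omega) (by omega)]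
    simp [bEps]
  have be : gBr n (bEps n (n-4-k)) (bEta n) = 0 := by
    rw [hb ⟨_, bEta_mem_mSub⟩, epsCoef_bEta]
    simp [bEta]
  ext x y : 2
  have ha : ∀ (ψ : MT n k → MT n k → Gg n) (x y : MT n k), act2 n k (bEps n (n-4-k)) ψ x y =
      gBr n (bEps n (n-4-k)) (ψ x y) - ψ (θ x) y - ψ x (θ y) := fun _ _ _ => rfl
  simp only [ha, topCochain, tp, tq, te, tX, gBr_sub_right, gBr_smul_right, bq, be, gBr_zero_right, cC,
    smul_zero, Pi.smul_apply]
  rw [show (-6 : ℝ) = -6 * (s * s) by rw [hss, mul_one]]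
  module

lemma cB_mem_C1plus (hn : 5 < n) (hk : k ≤ n - 5) : cB n k ∈ C1plus n k := by
  refine Submodule.subset_span ⟨⟨fun x y => ?_, fun c x => ?_⟩, 1, one_pos, fun p _ x hx => ?_⟩
  · simp [cB, add_smul]
  · simp [cB, mul_smul]
  · by_cases hp : p = -1
    · exact Submodule.smul_mem _ _ (bEps_mem_gComp (by omega) (by omega) (by omega))
    · simp [cB, gComp_coef_X hx hp]

lemma cobound_cB (hn : 5 < n) (hk : k ≤ n - 5) :
    cobound n k (cB n k) = ((-1 : ℝ) ^ (n - 4 - k)) • cC n k := by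
  have hb : ∀ x : MT n k, gBr n x.1 (bEps n (n-4-k)) = (x.1.1 3) • bEps n (n-3-k) -
      ((-1 : ℝ) ^ (n - 4 - k) * epsCoef n (n-1+k) x.1) • bEta n := by
    intro x
    rw [gBr_swap (bEps n (n-4-k)), gBr_bEps (by omega) (by omega) x.2.1 x.2.2.1 x.2.2.2.1,
      show n - 4 - k + 1 = n - 3 - k by omega, show 2 * n - 5 - (n - 4 - k) = n - 1 + k by omega]
    module
  have h0 : ∀ x y : MT n k, (mBrM n k x y).1.1 3 = 0 := by
    intro x y
    change 2 * (x.1.1 1 * y.1.1 3 - x.1.1 3 * y.1.1 1) = 0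
    rw [x.2.2.1, y.2.2.1]
    ring
  ext x y : 2
  simp only [cobound, cB, h0, gBr_smul_right, hb, cC, Pi.smul_apply]
  module

lemma cC_ne_zero (hn : 5 < n) (hk : k ≤ n - 5) : cC n k ≠ 0 := by
  intro h
  have h1 := congrArg (fun u => u.2.2) (congrFun (congrFun h ⟨bX n, bX_mem_mSub⟩)
    ⟨bEps n (n-1+k), bEps_mem_mSub (by omega)⟩)
  simp only [cC, epsCoef_bEps (show 1 ≤ n - 1 + k by omega) (show n - 1 + k ≤ 2 * n - 6 by omega)]
    at h1
  simp [bX, bEps, bEta, etaV] at h1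

lemma cC_mem_imDel (hn : 5 < n) (hk : k ≤ n - 5) : cC n k ∈ imDel n k := by
  have h : cC n k = ((-1 : ℝ) ^ (n - 4 - k)) • cobound n k (cB n k) := by
    rw [cobound_cB hn hk, smul_smul, ← mul_pow]
    simp
  rw [h]
  exact Submodule.smul_mem _ _ (Submodule.subset_span ⟨_, cB_mem_C1plus hn hk, rfl⟩)

lemma bEps_mem_g0Sub : bEps n (n-4-k) ∈ g0Sub n k := by
  refine ⟨rfl, rfl, fun i hi => ?_⟩
  simp only [bEps, epsV]
  rw [if_neg]
  omega

end Cochains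

set_option synthInstance.maxHeartbeats 1000000

/-- for every `n > 5` and `0 ≤ k ≤ n-5`, the symbol `s^{k,n}` admits no
linear invariant normalization condition: there is no subspace `N ⊆ C²₊(m,g)`,
invariant under the `g⁰`-action and spanned by weight-homogeneous elements, with
`C²₊(m,g) = N ⊕ ∂(C¹₊(m,g))`. -/
theorem no_invariant_normalization_condition (n k : ℕ) (hn : 5 < n) (hk : k ≤ n - 5) :
    ¬ ∃ N : Submodule ℝ (MT n k → MT n k → Gg n),
        N ≤ C2plus n k ∧
        (∀ A ∈ g0Sub n k, ∀ ψ ∈ N, act2 n k A ψ ∈ N) ∧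
        N = Submodule.span ℝ {ψ | ψ ∈ N ∧ ∃ w : ℤ, Homog2 n k w ψ} ∧
        N ⊔ imDel n k = C2plus n k ∧
        Disjoint N (imDel n k) := by
  rintro ⟨N, -, hinv, -, hsup, hdisj⟩
  have hmem := topCochain_mem_C2plus hn hk
  rw [← hsup, Submodule.mem_sup] at hmem
  obtain ⟨ν, hν, δ, hδ, hνδ⟩ := hmem
  have heig : ∀ a b : ℝ, act2 n k (tor n a b) δ = (a * (4 * k + 4) - 2 * b) • δ := by
    intro a b
    have h1 := act2_tor_topCochain hn hk a b
    rw [← hνδ, act2_add, smul_add] at h1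
    rw [← sub_eq_zero]
    refine Submodule.disjoint_def.mp hdisj _ ?_
      (sub_mem (act2_tor_mem_imDel a b hδ) (Submodule.smul_mem _ _ hδ))
    rw [show act2 n k (tor n a b) δ - (a * (4 * k + 4) - 2 * b) • δ =
        (a * (4 * k + 4) - 2 * b) • ν - act2 n k (tor n a b) ν by
      rw [sub_eq_sub_iff_add_eq_add, add_comm, h1]]
    exact sub_mem (Submodule.smul_mem _ _ hν) (hinv _ (tor_mem_g0Sub a b) _ hν)
  have hδ0 : δ = 0 := by
    obtain ⟨φ, hφ, rfl⟩ := exists_of_mem_imDel hδ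
    refine cobound_eq_zero hn hk (isLin1_of_mem_C1plus hφ) (l := 4 * k + 4) ?_ ?_ ?_
    · have : (0 : ℝ) ≤ k := Nat.cast_nonneg k
      linarith
    · rw [heig]
      norm_num
    · rw [heig]
      norm_num
  rw [hδ0, add_zero] at hνδ
  have he : bEps n (n-4-k) ∈ g0Sub n k := bEps_mem_g0Sub
  have h3 := hinv _ he _ (hinv _ he _ (hinv _ he _ hν))
  rw [hνδ, act2_act2_act2_topCochain hn hk] at h3
  have h4 := Submodule.disjoint_def.mp hdisj _ h3
    (Submodule.smul_mem _ _ (cC_mem_imDel hn hk))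
  exact cC_ne_zero hn hk ((smul_eq_zero.mp h4).resolve_left (by norm_num))
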